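/- Let d ≥ 3 be an integer and α ∈ (2,∞). There exists a constant c₀ > 0 with the following property. Let K > 0 and let V : ℝ^d → ℝ be a measurable function satisfying −K(1+|z|)^{-α} ≤ V(z) ≤ 0 for all z ∈ ℝ^d. Define the Duhamel iterates by p₀(t,x,y) := q(t,x,y) and p_{n+1}(t,x,y) := ∫₀^t ∫_{ℝ^d} q(t−s,x,z) (−V(z)) p_n(s,z,y) dz ds. Then for every n ≥ 1, every t > 0 and all x,y ∈ ℝ^d, p_n(t,x,y) ≤ (c₀ K)^n t^{-d/2} exp(−|x−y|²/(4t)). -/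

import Mathlib

open Real MeasureTheory

section GaussianKernel

variable {d : ℕ}

/-- The Gaussian heat kernel of `½Δ` on `ℝ^d`. -/
noncomputable def gaussKernel (t : ℝ) (x y : EuclideanSpace ℝ (Fin d)) : ℝ :=
  (2 * π * t) ^ (-(d : ℝ) / 2) * Real.exp (-(‖x - y‖ ^ 2 / (2 * t)))

lemma gaussKernel_nonneg {t : ℝ} (ht : 0 < t) (x y : EuclideanSpace ℝ (Fin d)) :
    0 ≤ gaussKernel t x y := by
  unfold gaussKernel
  positivity

lemma gaussKernel_le {t : ℝ} (ht : 0 < t) (x y : EuclideanSpace ℝ (Fin d)) :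
    gaussKernel t x y ≤ t ^ (-(d : ℝ) / 2) := by
  unfold gaussKernel
  have hd : -(d : ℝ) / 2 ≤ 0 := by
    have : (0 : ℝ) ≤ d := d.cast_nonneg
    linarith
  have h1 : (2 * π * t) ^ (-(d : ℝ) / 2) ≤ t ^ (-(d : ℝ) / 2) :=
    Real.rpow_le_rpow_of_nonpos ht (by nlinarith [Real.pi_gt_three]) hd
  have h2 : Real.exp (-(‖x - y‖ ^ 2 / (2 * t))) ≤ 1 :=
    Real.exp_le_one_iff.2 (neg_nonpos.2 (by positivity))
  calc _ ≤ t ^ (-(d : ℝ) / 2) * 1 := by gcongr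
    _ = _ := mul_one _

lemma gaussKernel_le_exp_quarter {t : ℝ} (ht : 0 < t) (x y : EuclideanSpace ℝ (Fin d)) :
    gaussKernel t x y ≤ t ^ (-(d : ℝ) / 2) * Real.exp (-(‖x - y‖ ^ 2 / (4 * t))) := by
  unfold gaussKernel
  have hd : -(d : ℝ) / 2 ≤ 0 := by
    have : (0 : ℝ) ≤ d := d.cast_nonneg
    linarith
  have h1 : (2 * π * t) ^ (-(d : ℝ) / 2) ≤ t ^ (-(d : ℝ) / 2) :=
    Real.rpow_le_rpow_of_nonpos ht (by nlinarith [Real.pi_gt_three]) hd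
  gcongr
  norm_num

lemma integral_gaussKernel {t : ℝ} (ht : 0 < t) (m : EuclideanSpace ℝ (Fin d)) :
    ∫ z, gaussKernel t z m = 1 := by
  unfold gaussKernel
  rw [integral_const_mul,
    integral_sub_right_eq_self (fun z : EuclideanSpace ℝ (Fin d) =>
      Real.exp (-(‖z‖ ^ 2 / (2 * t)))) m]
  have h := GaussianFourier.integral_rexp_neg_mul_sq_norm (V := EuclideanSpace ℝ (Fin d))
    (b := 1 / (2 * t)) (by positivity)
  have e : (fun z : EuclideanSpace ℝ (Fin d) => Real.exp (-(‖z‖ ^ 2 / (2 * t)))) =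
      fun z => Real.exp (-(1 / (2 * t)) * ‖z‖ ^ 2) := by
    funext z
    congr 1
    ring
  rw [e, h, finrank_euclideanSpace_fin, show π / (1 / (2 * t)) = 2 * π * t by field_simp,
    ← Real.rpow_add (by positivity), neg_div, neg_add_cancel, Real.rpow_zero]

lemma integrable_gaussKernel {t : ℝ} (ht : 0 < t) (m : EuclideanSpace ℝ (Fin d)) :
    Integrable fun z => gaussKernel t z m :=
  Integrable.of_integral_ne_zero (by rw [integral_gaussKernel ht m]; exact one_ne_zero)

/-- The Brownian bridge factorization of a product of heat kernels. -/
lemma gaussKernel_mul_gaussKernel {a b : ℝ} (ha : 0 < a) (hb : 0 < b)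
    (x y z : EuclideanSpace ℝ (Fin d)) :
    gaussKernel a x z * gaussKernel b z y =
      gaussKernel (a + b) x y *
        gaussKernel (a * b / (a + b)) z ((b / (a + b)) • x + (a / (a + b)) • y) := by
  have hab : 0 < a + b := add_pos ha hb
  have key : ‖x - z‖ ^ 2 / (2 * a) + ‖z - y‖ ^ 2 / (2 * b) = ‖x - y‖ ^ 2 / (2 * (a + b)) +
      ‖z - ((b / (a + b)) • x + (a / (a + b)) • y)‖ ^ 2 / (2 * (a * b / (a + b))) := by
    have e1 : x - y = (x - z) + (z - y) := by abel
    have e2 : z - ((b / (a + b)) • x + (a / (a + b)) • y) =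
        (a / (a + b)) • (z - y) - (b / (a + b)) • (x - z) := by
      have h : z = (a / (a + b)) • z + (b / (a + b)) • z := by
        rw [← add_smul, ← add_div, div_self hab.ne', one_smul]
      nth_rewrite 1 [h]
      simp only [smul_sub]
      abel
    rw [e2, e1]
    generalize x - z = u
    generalize z - y = w
    rw [norm_add_sq_real, norm_sub_sq_real, norm_smul, norm_smul, real_inner_smul_left,
      real_inner_smul_right, real_inner_comm u w, Real.norm_of_nonneg (by positivity),
      Real.norm_of_nonneg (by positivity)]
    field_simp
    ring
  unfold gaussKernel
  rw [mul_mul_mul_comm ((2 * π * a) ^ (-(d : ℝ) / 2)),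
    mul_mul_mul_comm ((2 * π * (a + b)) ^ (-(d : ℝ) / 2)), ← Real.exp_add, ← Real.exp_add,
    ← Real.mul_rpow (by positivity) (by positivity),
    ← Real.mul_rpow (by positivity) (by positivity), ← neg_add, ← neg_add, key]
  congr 2
  field_simp

lemma integrableOn_rpow_sub_one_sub {β : ℝ} (hβ : β < d) {R : ℝ} (hR : 0 < R) :
    IntegrableOn (fun y : ℝ => y ^ ((d : ℝ) - 1 - β)) (Set.Ioc 0 R) :=
  (intervalIntegrable_iff_integrableOn_Ioc_of_le hR.le).1
    (intervalIntegral.intervalIntegrable_rpow' (by linarith))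

lemma radial_weight_eqOn (hd : 0 < d) (β R : ℝ) :
    Set.EqOn (fun y : ℝ => y ^ (d - 1) • (Set.Iic R).indicator (fun r : ℝ => r ^ (-β)) y)
      ((Set.Iic R).indicator fun y : ℝ => y ^ ((d : ℝ) - 1 - β)) (Set.Ioi 0) := by
  intro y hy
  have hy : 0 < y := hy
  by_cases h : y ∈ Set.Iic R
  · simp only [Set.indicator_of_mem h, smul_eq_mul]
    rw [← Real.rpow_natCast, ← Real.rpow_add hy, Nat.cast_sub hd, Nat.cast_one, sub_eq_add_neg _ β]
  · simp [Set.indicator_of_notMem h]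

lemma integrable_indicator_norm_rpow (hd : 0 < d) {β : ℝ} (hβ : β < d) {R : ℝ} (hR : 0 < R) :
    Integrable fun z : EuclideanSpace ℝ (Fin d) =>
      (Set.Iic R).indicator (fun r : ℝ => r ^ (-β)) ‖z‖ := by
  have : Nonempty (Fin d) := ⟨⟨0, hd⟩⟩
  rw [integrable_fun_norm_addHaar volume, finrank_euclideanSpace_fin,
    integrableOn_congr_fun (radial_weight_eqOn hd β R) measurableSet_Ioi, IntegrableOn,
    integrable_indicator_iff measurableSet_Iic, IntegrableOn,
    Measure.restrict_restrict measurableSet_Iic, Set.inter_comm, Set.Ioi_inter_Iic]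
  exact integrableOn_rpow_sub_one_sub hβ hR

lemma integral_indicator_norm_rpow (hd : 0 < d) {β : ℝ} (hβ : β < d) {R : ℝ} (hR : 0 < R) :
    ∫ z : EuclideanSpace ℝ (Fin d), (Set.Iic R).indicator (fun r : ℝ => r ^ (-β)) ‖z‖ =
      d * volume.real (Metric.ball (0 : EuclideanSpace ℝ (Fin d)) 1) / (d - β) *
        R ^ ((d : ℝ) - β) := by
  have : Nonempty (Fin d) := ⟨⟨0, hd⟩⟩
  rw [integral_fun_norm_addHaar volume, finrank_euclideanSpace_fin,
    setIntegral_congr_fun measurableSet_Ioi (radial_weight_eqOn hd β R),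
    setIntegral_indicator measurableSet_Iic, Set.Ioi_inter_Iic,
    ← intervalIntegral.integral_of_le hR.le, integral_rpow (Or.inl (by linarith)),
    show (d : ℝ) - 1 - β + 1 = d - β by ring, Real.zero_rpow (by linarith)]
  simp only [nsmul_eq_mul, smul_eq_mul]
  ring

lemma integrable_weight_mul_gaussKernel {t : ℝ} (ht : 0 < t) {β : ℝ} (hβ : 0 ≤ β)
    (m : EuclideanSpace ℝ (Fin d)) :
    Integrable fun z => (1 + ‖z‖) ^ (-β) * gaussKernel t z m := by
  refine (integrable_gaussKernel ht m).bdd_mul (c := 1) ?_ ?_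
  · exact (Measurable.pow_const (by fun_prop) _).aestronglyMeasurable
  · refine Filter.Eventually.of_forall fun z => ?_
    rw [Real.norm_of_nonneg (by positivity)]
    exact Real.rpow_le_one_of_one_le_of_nonpos (by linarith [norm_nonneg z]) (by linarith)

lemma integral_weight_mul_gaussKernel_le_one {t : ℝ} (ht : 0 < t) {β : ℝ} (hβ : 0 ≤ β)
    (m : EuclideanSpace ℝ (Fin d)) :
    ∫ z, (1 + ‖z‖) ^ (-β) * gaussKernel t z m ≤ 1 := by
  refine le_of_le_of_eq ?_ (integral_gaussKernel ht m)
  refine integral_mono (integrable_weight_mul_gaussKernel ht hβ m) (integrable_gaussKernel ht m)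
    fun z => mul_le_of_le_one_left (gaussKernel_nonneg ht z m) ?_
  exact Real.rpow_le_one_of_one_le_of_nonpos (by linarith [norm_nonneg z]) (by linarith)

lemma integral_weight_mul_gaussKernel_le_rpow (hd : 0 < d) {t : ℝ} (ht : 0 < t) {β : ℝ}
    (hβ : 0 ≤ β) (hβd : β < d) (m : EuclideanSpace ℝ (Fin d)) :
    ∫ z, (1 + ‖z‖) ^ (-β) * gaussKernel t z m ≤
      (1 + d * volume.real (Metric.ball (0 : EuclideanSpace ℝ (Fin d)) 1) / (d - β)) *
        t ^ (-(β / 2)) := by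
  have : Nonempty (Fin d) := ⟨⟨0, hd⟩⟩
  have hR : 0 < √t := Real.sqrt_pos.2 ht
  have hi1 := (integrable_gaussKernel ht m).const_mul (t ^ (-(β / 2)))
  have hi2 := (integrable_indicator_norm_rpow hd hβd hR).const_mul (t ^ (-(d : ℝ) / 2))
  have hne : ∀ᵐ z : EuclideanSpace ℝ (Fin d), z ≠ 0 := by
    simp [ae_iff]
  calc ∫ z, (1 + ‖z‖) ^ (-β) * gaussKernel t z m
      ≤ ∫ z, (t ^ (-(β / 2)) * gaussKernel t z m + t ^ (-(d : ℝ) / 2) *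
          (Set.Iic √t).indicator (fun r : ℝ => r ^ (-β)) ‖z‖) := by
        refine integral_mono_ae (integrable_weight_mul_gaussKernel ht hβ m) (hi1.add hi2) ?_
        filter_upwards [hne] with z hz
        have hz : 0 < ‖z‖ := norm_pos_iff.2 hz
        have hg := gaussKernel_nonneg ht z m
        by_cases h : ‖z‖ ∈ Set.Iic √t
        · simp only [Set.indicator_of_mem h]
          have h1 : (1 + ‖z‖) ^ (-β) ≤ ‖z‖ ^ (-β) :=
            Real.rpow_le_rpow_of_nonpos hz (by linarith) (by linarith)
          calc _ ≤ ‖z‖ ^ (-β) * t ^ (-(d : ℝ) / 2) := by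
                gcongr
                exact gaussKernel_le ht z m
            _ = t ^ (-(d : ℝ) / 2) * ‖z‖ ^ (-β) := mul_comm _ _
            _ ≤ _ := le_add_of_nonneg_left (by positivity)
        · simp only [Set.indicator_of_notMem h, mul_zero, add_zero]
          have h : √t < ‖z‖ := not_le.1 h
          gcongr
          calc (1 + ‖z‖) ^ (-β) ≤ (√t) ^ (-β) :=
                Real.rpow_le_rpow_of_nonpos hR (by linarith) (by linarith)
            _ = t ^ (-(β / 2)) := by
                rw [Real.sqrt_eq_rpow, ← Real.rpow_mul ht.le]
                congr 1
                ring
    _ = _ := by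
        rw [integral_add hi1 hi2, integral_const_mul, integral_const_mul, integral_gaussKernel ht,
          integral_indicator_norm_rpow hd hβd hR, Real.sqrt_eq_rpow, ← Real.rpow_mul ht.le,
          show -(β / 2) = -(d : ℝ) / 2 + 1 / 2 * (d - β) by ring, Real.rpow_add ht]
        ring

lemma exists_integral_weight_mul_gaussKernel_le (hd : 0 < d) {β : ℝ}
    (hβ : 0 ≤ β) (hβd : β < d) :
    ∃ M : ℝ, 0 < M ∧ ∀ t : ℝ, 0 < t → ∀ m : EuclideanSpace ℝ (Fin d),
      ∫ z, (1 + ‖z‖) ^ (-β) * gaussKernel t z m ≤ M * (1 + t) ^ (-(β / 2)) := by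
  set C := d * volume.real (Metric.ball (0 : EuclideanSpace ℝ (Fin d)) 1) / (d - β) with hC
  have hC0 : 0 ≤ C := div_nonneg (by positivity) (by linarith)
  refine ⟨(1 + C) * (1 / 2) ^ (-(β / 2)), by positivity, fun t ht m => ?_⟩
  rw [mul_assoc, ← Real.mul_rpow (by norm_num) (by linarith)]
  rcases le_total t 1 with h | h
  · refine (integral_weight_mul_gaussKernel_le_one ht hβ m).trans ?_
    have : 1 ≤ (1 / 2 * (1 + t)) ^ (-(β / 2)) :=
      Real.one_le_rpow_of_pos_of_le_one_of_nonpos (by linarith) (by linarith) (by linarith)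
    nlinarith
  · refine (integral_weight_mul_gaussKernel_le_rpow hd ht hβ hβd m).trans ?_
    rw [← hC]
    gcongr 1
    · exact Real.rpow_le_rpow_of_nonpos (by linarith) (by linarith) (by linarith)

lemma integral_one_add_half_rpow_le {γ : ℝ} (hγ : 1 < γ) {t : ℝ} (ht : 0 < t) :
    ∫ s in (0 : ℝ)..t, (1 + s / 2) ^ (-γ) ≤ 2 / (γ - 1) := by
  have h := intervalIntegral.integral_comp_add_div (a := 0) (b := t)
    (fun u : ℝ => u ^ (-γ)) (two_ne_zero) 1
  rw [h, integral_rpow]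
  · have h1 : 0 ≤ (1 + t / 2) ^ (-γ + 1) := by positivity
    rw [zero_div, add_zero, Real.one_rpow, smul_eq_mul, show -γ + 1 = -(γ - 1) by ring,
      div_neg, ← neg_div, neg_sub, ← mul_div_assoc]
    rw [show -γ + 1 = -(γ - 1) by ring] at h1
    have : 0 < γ - 1 := by linarith
    gcongr
    linarith
  · right
    refine ⟨by linarith, ?_⟩
    rw [Set.uIcc_of_le (by linarith)]
    intro h0
    have := h0.1
    linarith

lemma intervalIntegrable_one_add_half_rpow (γ : ℝ) {t : ℝ} (ht : 0 < t) :
    IntervalIntegrable (fun s : ℝ => (1 + s / 2) ^ (-γ)) volume 0 t := by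
  refine ContinuousOn.intervalIntegrable fun s hs => ?_
  rw [Set.uIcc_of_le ht.le] at hs
  have : 1 + s / 2 ≠ 0 := by linarith [hs.1]
  have hc : ContinuousAt (fun s : ℝ => 1 + s / 2) s := by fun_prop
  exact (hc.rpow_const (Or.inl this)).continuousWithinAt

lemma integral_bridge_rpow_le {γ : ℝ} (hγ : 1 < γ) {t : ℝ} (ht : 0 < t) :
    IntegrableOn (fun s : ℝ => (1 + s / 2) ^ (-γ) + (1 + (t - s) / 2) ^ (-γ)) (Set.Ioo 0 t) ∧
    ∫ s in Set.Ioo 0 t, ((1 + s / 2) ^ (-γ) + (1 + (t - s) / 2) ^ (-γ)) ≤ 4 / (γ - 1) := by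
  have h1 := intervalIntegrable_one_add_half_rpow γ ht
  have h2 : IntervalIntegrable (fun s : ℝ => (1 + (t - s) / 2) ^ (-γ)) volume 0 t := by
    simpa using (h1.comp_sub_left t).symm
  refine ⟨((intervalIntegrable_iff_integrableOn_Ioo_of_le ht.le).1 (h1.add h2)), ?_⟩
  rw [← integral_Ioc_eq_integral_Ioo, ← intervalIntegral.integral_of_le ht.le,
    intervalIntegral.integral_add h1 h2,
    intervalIntegral.integral_comp_sub_left (fun s : ℝ => (1 + s / 2) ^ (-γ)) t, sub_self,
    sub_zero]
  have := integral_one_add_half_rpow_le hγ ht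
  have e : 4 / (γ - 1) = 2 / (γ - 1) + 2 / (γ - 1) := by ring
  linarith

lemma one_add_bridge_rpow_le {γ : ℝ} (hγ : 0 ≤ γ) {a b : ℝ} (ha : 0 < a) (hb : 0 < b) :
    (1 + a * b / (a + b)) ^ (-γ) ≤ (1 + b / 2) ^ (-γ) + (1 + a / 2) ^ (-γ) := by
  rcases le_total a b with h | h
  · have h1 : a / 2 ≤ a * b / (a + b) := by
      rw [div_le_div_iff₀ two_pos (by positivity)]
      nlinarith
    have := Real.rpow_le_rpow_of_nonpos (x := 1 + a / 2) (y := 1 + a * b / (a + b)) (z := -γ)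
      (by positivity) (by linarith) (by linarith)
    have h0 : 0 ≤ (1 + b / 2) ^ (-γ) := by positivity
    linarith
  · have h1 : b / 2 ≤ a * b / (a + b) := by
      rw [div_le_div_iff₀ two_pos (by positivity)]
      nlinarith
    have := Real.rpow_le_rpow_of_nonpos (x := 1 + b / 2) (y := 1 + a * b / (a + b)) (z := -γ)
      (by positivity) (by linarith) (by linarith)
    have h0 : 0 ≤ (1 + a / 2) ^ (-γ) := by positivity
    linarith

end GaussianKernel

theorem stmt_8 (d : ℕ) (hd : 3 ≤ d) (α : ℝ) (hα : 2 < α) :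
    ∃ c₀ : ℝ, 0 < c₀ ∧
      ∀ (K : ℝ), 0 < K →
        ∀ (V : EuclideanSpace ℝ (Fin d) → ℝ), Measurable V →
          (∀ z, -K * (1 + ‖z‖) ^ (-α) ≤ V z ∧ V z ≤ 0) →
          ∀ (p : ℕ → ℝ → EuclideanSpace ℝ (Fin d) → EuclideanSpace ℝ (Fin d) → ℝ),
            (∀ t x y, p 0 t x y =
              (2 * π * t) ^ (-(d : ℝ) / 2) * Real.exp (-(‖x - y‖ ^ 2 / (2 * t)))) →
            (∀ n t x y, p (n + 1) t x y =
              ∫ s in Set.Ioo (0:ℝ) t, ∫ z : EuclideanSpace ℝ (Fin d),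
                (2 * π * (t - s)) ^ (-(d : ℝ) / 2) *
                  Real.exp (-(‖x - z‖ ^ 2 / (2 * (t - s)))) * (-V z) * p n s z y) →
            ∀ n : ℕ, 1 ≤ n → ∀ (t : ℝ), 0 < t → ∀ x y,
              p n t x y ≤ (c₀ * K) ^ n * t ^ (-(d : ℝ) / 2) *
                Real.exp (-(‖x - y‖ ^ 2 / (4 * t))) := by
  obtain ⟨β, hβ2, hβα, hβd⟩ : ∃ β : ℝ, 2 < β ∧ β ≤ α ∧ β < d := by
    have : (3 : ℝ) ≤ d := by exact_mod_cast hd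
    refine ⟨min α (5 / 2), lt_min hα (by norm_num), min_le_left _ _, ?_⟩
    exact (min_le_right _ _).trans_lt (by linarith)
  obtain ⟨M, hM, hMb⟩ := exists_integral_weight_mul_gaussKernel_le
    (d := d) (by omega) (by linarith) hβd
  have hγ : 1 < β / 2 := by linarith
  have hγ' : 0 < β / 2 - 1 := by linarith
  set c₀ := M * (4 / (β / 2 - 1)) with hc₀
  have hc₀pos : 0 < c₀ := by positivity
  refine ⟨c₀, hc₀pos, fun K hK V _ hV p hp0 hp n _ t ht x y => ?_⟩
  have hp' : ∀ n t x y, p (n + 1) t x y = ∫ s in Set.Ioo (0:ℝ) t,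
      ∫ z : EuclideanSpace ℝ (Fin d), gaussKernel (t - s) x z * (-V z) * p n s z y := hp
  have main : ∀ n t, 0 < t → ∀ x y,
      0 ≤ p n t x y ∧ p n t x y ≤ (c₀ * K) ^ n * gaussKernel t x y := by
    intro n
    induction n with
    | zero =>
      intro t ht x y
      have h : p 0 t x y = gaussKernel t x y := hp0 t x y
      rw [h, pow_zero, one_mul]
      exact ⟨gaussKernel_nonneg ht x y, le_rfl⟩
    | succ n ih =>
      intro t ht x y
      have hnn : ∀ s ∈ Set.Ioo 0 t, ∀ z, 0 ≤ gaussKernel (t - s) x z * (-V z) * p n s z y :=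
        fun s hs z => mul_nonneg (mul_nonneg (gaussKernel_nonneg (sub_pos.2 hs.2) x z)
          (neg_nonneg.2 (hV z).2)) (ih s hs.1 z y).1
      have hinner : ∀ s ∈ Set.Ioo 0 t,
          ∫ z, gaussKernel (t - s) x z * (-V z) * p n s z y ≤
            (K * (c₀ * K) ^ n * gaussKernel t x y * M) *
              ((1 + s / 2) ^ (-(β / 2)) + (1 + (t - s) / 2) ^ (-(β / 2))) := by
        intro s hs
        have hs0 : 0 < s := hs.1
        have hts : 0 < t - s := sub_pos.2 hs.2
        have hg := gaussKernel_nonneg ht x y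
        set τ := (t - s) * s / t with hτ
        have hτ0 : 0 < τ := by positivity
        set m := (s / t) • x + ((t - s) / t) • y with hm
        have hbridge : ∀ z, gaussKernel (t - s) x z * gaussKernel s z y =
            gaussKernel t x y * gaussKernel τ z m := fun z => by
          simpa [hτ, hm] using gaussKernel_mul_gaussKernel hts hs0 x y z
        calc ∫ z, gaussKernel (t - s) x z * (-V z) * p n s z y
            ≤ ∫ z, (K * (c₀ * K) ^ n * gaussKernel t x y) *
                ((1 + ‖z‖) ^ (-β) * gaussKernel τ z m) := by
              refine integral_mono_of_nonneg (Filter.Eventually.of_forall (hnn s hs))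
                ((integrable_weight_mul_gaussKernel hτ0 (by linarith) m).const_mul _)
                (Filter.Eventually.of_forall fun z => ?_)
              have hVz : -V z ≤ K * (1 + ‖z‖) ^ (-β) := by
                have h1 : (1 + ‖z‖) ^ (-α) ≤ (1 + ‖z‖) ^ (-β) :=
                  Real.rpow_le_rpow_of_exponent_le (by linarith [norm_nonneg z]) (by linarith)
                nlinarith [(hV z).1]
              calc gaussKernel (t - s) x z * (-V z) * p n s z y
                  ≤ gaussKernel (t - s) x z * (K * (1 + ‖z‖) ^ (-β)) *
                      ((c₀ * K) ^ n * gaussKernel s z y) := by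
                    have := gaussKernel_nonneg hts x z
                    have := (ih s hs0 z y).1
                    have := (ih s hs0 z y).2
                    gcongr
                _ = K * (1 + ‖z‖) ^ (-β) * (c₀ * K) ^ n *
                      (gaussKernel (t - s) x z * gaussKernel s z y) := by ring
                _ = _ := by rw [hbridge]; ring
          _ ≤ (K * (c₀ * K) ^ n * gaussKernel t x y) * (M * (1 + τ) ^ (-(β / 2))) := by
              rw [integral_const_mul]
              gcongr
              exact hMb τ hτ0 m
          _ ≤ (K * (c₀ * K) ^ n * gaussKernel t x y) *
                (M * ((1 + s / 2) ^ (-(β / 2)) + (1 + (t - s) / 2) ^ (-(β / 2)))) := by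
              gcongr
              simpa [hτ] using one_add_bridge_rpow_le (by linarith : 0 ≤ β / 2) hts hs0
          _ = _ := by ring
      rw [hp']
      refine ⟨setIntegral_nonneg measurableSet_Ioo fun s hs => integral_nonneg (hnn s hs), ?_⟩
      obtain ⟨hint, hle⟩ := integral_bridge_rpow_le hγ ht
      have hg := gaussKernel_nonneg ht x y
      calc _ ≤ ∫ s in Set.Ioo 0 t, (K * (c₀ * K) ^ n * gaussKernel t x y * M) *
              ((1 + s / 2) ^ (-(β / 2)) + (1 + (t - s) / 2) ^ (-(β / 2))) :=
            integral_mono_of_nonneg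
              (ae_restrict_of_forall_mem measurableSet_Ioo fun s hs => integral_nonneg (hnn s hs))
              (hint.const_mul _) (ae_restrict_of_forall_mem measurableSet_Ioo hinner)
        _ ≤ (K * (c₀ * K) ^ n * gaussKernel t x y * M) * (4 / (β / 2 - 1)) := by
            rw [integral_const_mul]
            gcongr
        _ = (c₀ * K) ^ (n + 1) * gaussKernel t x y := by
            rw [pow_succ, hc₀]
            ring
  rw [mul_assoc]
  exact (main n t ht x y).2.trans
    (mul_le_mul_of_nonneg_left (gaussKernel_le_exp_quarter ht x y) (by positivity))
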